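/- Uniqueness of the interface profile: let ψ : ℝ → ℝ be twice continuously differentiable with ψ''(ξ) = ψ(ξ)³ − ψ(ξ) for all ξ ∈ ℝ, ψ(0) = 0, ψ(ξ) → 1 as ξ → +∞, ψ(ξ) → −1 as ξ → −∞, and ψ'(ξ) → 0 as ξ → ±∞. Then ψ(ξ) = tanh(ξ/√2) for all ξ ∈ ℝ. -/

import Mathlib

open Filter Topology

theorem lin_zero (c d : ℝ → ℝ) (hc : Continuous c)
    (hd : ∀ x, HasDerivAt d (c x * d x) x) (h0 : d 0 = 0) : ∀ x, d x = 0 := by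
  intro x
  have hP : ∀ x, HasDerivAt (fun x => ∫ t in (0:ℝ)..x, c t) (c x) x := fun x =>
    intervalIntegral.integral_hasDerivAt_right (hc.intervalIntegrable _ _)
      hc.stronglyMeasurable.stronglyMeasurableAtFilter hc.continuousAt
  have hQ : ∀ x, HasDerivAt (fun x => d x * Real.exp (-∫ t in (0:ℝ)..x, c t)) 0 x := by
    intro x
    have := (hd x).mul (hP x).neg.exp
    refine HasDerivAt.congr_deriv this ?_
    simp only [Pi.neg_apply]
    ring
  have := is_const_of_deriv_eq_zero (fun x => (hQ x).differentiableAt)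
    (fun x => (hQ x).deriv) x 0
  simpa [h0] using this

theorem tanh_deriv (x : ℝ) : HasDerivAt (fun x => Real.tanh (x / Real.sqrt 2))
    ((1 - Real.tanh (x / Real.sqrt 2) ^ 2) / Real.sqrt 2) x := by
  have h1 : HasDerivAt (fun x : ℝ => x / Real.sqrt 2) (1 / Real.sqrt 2) x :=
    (hasDerivAt_id x).div_const _
  have hc := (Real.cosh_pos (x / Real.sqrt 2)).ne'
  have h := h1.sinh.div h1.cosh hc
  have e : (fun x => Real.tanh (x / Real.sqrt 2)) =
      (fun x => Real.sinh (x / Real.sqrt 2)) / (fun x => Real.cosh (x / Real.sqrt 2)) := by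
    funext y
    simp [Real.tanh_eq_sinh_div_cosh]
  rw [e]
  refine HasDerivAt.congr_deriv h ?_
  rw [Real.tanh_eq_sinh_div_cosh]
  field_simp

/-- Uniqueness of the interface profile: any `C²` solution of `ψ'' = ψ³ − ψ` on `ℝ` with
`ψ(0) = 0`, `ψ → ±1` at `±∞` and `ψ' → 0` at `±∞` is the tanh profile `tanh(ξ/√2)`. -/
theorem interface_profile_unique (ψ : ℝ → ℝ)
    (hψ : ContDiff ℝ 2 ψ)
    (heq : ∀ ξ : ℝ, deriv (deriv ψ) ξ = (ψ ξ) ^ 3 - ψ ξ)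
    (h0 : ψ 0 = 0)
    (htop : Tendsto ψ atTop (𝓝 1))
    (hbot : Tendsto ψ atBot (𝓝 (-1)))
    (h'top : Tendsto (deriv ψ) atTop (𝓝 0))
    (h'bot : Tendsto (deriv ψ) atBot (𝓝 0)) :
    ∀ ξ : ℝ, ψ ξ = Real.tanh (ξ / Real.sqrt 2) := by
  have hd1 : ∀ x, HasDerivAt ψ (deriv ψ x) x := fun x =>
    (hψ.differentiable (by norm_num) x).hasDerivAt
  have hd2 : ∀ x, HasDerivAt (deriv ψ) (ψ x ^ 3 - ψ x) x := fun x => by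
    rw [← heq]
    have : ContDiff ℝ 1 (deriv ψ) := by
      have h : ContDiff ℝ (1 + 1) ψ := by simpa [one_add_one_eq_two] using hψ
      exact (contDiff_succ_iff_deriv.1 h).2.2
    exact (this.differentiable (by norm_num) x).hasDerivAt
  have hcψ : Continuous ψ := hψ.continuous
  have s0 : Real.sqrt 2 ≠ 0 := by positivity
  have s2 : Real.sqrt 2 * Real.sqrt 2 = 2 := Real.mul_self_sqrt (by norm_num)
  have hcg : Continuous (fun x => Real.tanh (x / Real.sqrt 2)) :=
    continuous_iff_continuousAt.2 fun x => (tanh_deriv x).continuousAt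
  have hE : ∀ x, HasDerivAt (fun x => 2 * deriv ψ x ^ 2 - (1 - ψ x ^ 2) ^ 2) 0 x := fun x => by
    have := (((hd2 x).pow 2).const_mul 2).sub ((((hd1 x).pow 2).const_sub 1).pow 2)
    refine HasDerivAt.congr_deriv this ?_
    simp
    ring
  have hE0 : 2 * deriv ψ 0 ^ 2 - (1 - ψ 0 ^ 2) ^ 2 = 0 := by
    have hl : Tendsto (fun x => 2 * deriv ψ x ^ 2 - (1 - ψ x ^ 2) ^ 2) atTop (𝓝 0) := by
      have := ((h'top.pow 2).const_mul 2).sub (((htop.pow 2).const_sub 1).pow 2)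
      simpa using this
    have hc : (fun x => 2 * deriv ψ x ^ 2 - (1 - ψ x ^ 2) ^ 2) =
        fun _ => 2 * deriv ψ 0 ^ 2 - (1 - ψ 0 ^ 2) ^ 2 := funext fun x =>
      is_const_of_deriv_eq_zero (fun x => (hE x).differentiableAt) (fun x => (hE x).deriv) x 0
    rw [hc] at hl
    exact tendsto_nhds_unique tendsto_const_nhds hl
  have hf : (Real.sqrt 2 * deriv ψ 0 - (1 - ψ 0 ^ 2)) *
      (Real.sqrt 2 * deriv ψ 0 + (1 - ψ 0 ^ 2)) = 0 := by
    linear_combination hE0 + deriv ψ 0 ^ 2 * s2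
  rcases mul_eq_zero.1 hf with h | h
  · have hA := lin_zero (fun x => Real.sqrt 2 * ψ x)
      (fun x => Real.sqrt 2 * deriv ψ x - (1 - ψ x ^ 2)) (by fun_prop) (fun x => by
        have := ((hd2 x).const_mul (Real.sqrt 2)).sub (((hd1 x).pow 2).const_sub 1)
        refine HasDerivAt.congr_deriv this ?_
        simp
        linear_combination -(ψ x * deriv ψ x) * s2) h
    have hD := lin_zero (fun x => -(ψ x + Real.tanh (x / Real.sqrt 2)) / Real.sqrt 2)
      (fun x => ψ x - Real.tanh (x / Real.sqrt 2)) (by fun_prop) (fun x => by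
        have := (hd1 x).sub (tanh_deriv x)
        refine HasDerivAt.congr_deriv this ?_
        have := hA x
        field_simp
        linear_combination this) (by simp [h0])
    intro x
    linarith [hD x]
  · have hA := lin_zero (fun x => -Real.sqrt 2 * ψ x)
      (fun x => Real.sqrt 2 * deriv ψ x + (1 - ψ x ^ 2)) (by fun_prop) (fun x => by
        have := ((hd2 x).const_mul (Real.sqrt 2)).add (((hd1 x).pow 2).const_sub 1)
        refine HasDerivAt.congr_deriv this ?_
        simp
        linear_combination (ψ x * deriv ψ x) * s2) h
    have hD := lin_zero (fun x => (ψ x - Real.tanh (x / Real.sqrt 2)) / Real.sqrt 2)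
      (fun x => ψ x + Real.tanh (x / Real.sqrt 2)) (by fun_prop) (fun x => by
        have := (hd1 x).add (tanh_deriv x)
        refine HasDerivAt.congr_deriv this ?_
        have := hA x
        field_simp
        linear_combination this) (by simp [h0])
    exfalso
    have hle : (1:ℝ) ≤ 0 := le_of_tendsto htop (by
      filter_upwards [eventually_ge_atTop 0] with x hx
      have h1 : 0 ≤ Real.tanh (x / Real.sqrt 2) := by
        rw [Real.tanh_eq_sinh_div_cosh]
        exact div_nonneg (Real.sinh_nonneg_iff.2 (by positivity)) (Real.cosh_pos _).le
      linarith [hD x])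
    linarith
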